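/- arXiv:1712.01894 — 2 statements merged into one kernel-verified Lean document; each statement's English description precedes it below -/
import Mathlib

section
/- Let α ∈ (0,1) and let z ∈ ℝ satisfy Φ(z) = 1 − α. Then as λ → ∞ along the positive reals, the probability that a Poisson random variable with mean λ is at most λ + z·√λ converges to 1 − α: Tendsto (fun λ : ℝ => ∑' n : ℕ, if (n : ℝ) ≤ λ + z * Real.sqrt λ then Real.exp (−λ) * λ ^ n / n ! else 0) atTop (𝓝 (1 − α)). -/
open Filter MeasureTheory ProbabilityTheory

/-- The standard normal cumulative distribution function. -/
noncomputable def Phi (z : ℝ) : ℝ := ((gaussianReal 0 1) (Set.Iic z)).toReal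

open scoped NNReal Topology

/-- The law of `(N - r) / √r`, where `N` has the Poisson distribution with mean `r`. -/
noncomputable def standardizedPoisson (r : ℝ≥0) : ProbabilityMeasure ℝ :=
  ⟨(poissonMeasure r).map (fun n : ℕ => ((n : ℝ) - r) / √(r : ℝ)),
    Measure.isProbabilityMeasure_map .of_discrete⟩

lemma charFun_standardizedPoisson {r : ℝ≥0} (hr : 0 < r) (t : ℝ) :
    charFun (standardizedPoisson r : Measure ℝ) t =
      Complex.exp (r * (Complex.exp (↑(t / √(r : ℝ)) * Complex.I) - 1
        - ↑(t / √(r : ℝ)) * Complex.I)) := by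
  have hs : (√(r : ℝ) : ℂ) ≠ 0 := by
    exact_mod_cast (Real.sqrt_pos.2 (NNReal.coe_pos.2 hr)).ne'
  have hcast := charFun_map_cast_poissonMeasure r (t / √(r : ℝ))
  rw [charFun_apply_real, integral_map .of_discrete (by fun_prop)] at hcast
  change charFun ((poissonMeasure r).map _) t = _
  rw [charFun_apply_real, integral_map .of_discrete (by fun_prop)]
  calc ∫ n : ℕ, Complex.exp (t * ↑(((n : ℝ) - r) / √(r : ℝ)) * Complex.I) ∂poissonMeasure r
      = ∫ n : ℕ, Complex.exp (↑(t / √(r : ℝ)) * ↑(n : ℝ) * Complex.I)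
          * Complex.exp (-(r * (↑(t / √(r : ℝ)) * Complex.I))) ∂poissonMeasure r := by
        congr with n
        rw [← Complex.exp_add]
        congr 1
        push_cast
        field_simp
        ring
    _ = _ := by
        rw [integral_mul_const, hcast, ← Complex.exp_add]
        congr 1
        ring

lemma tendsto_charFun_standardizedPoisson (t : ℝ) :
    Tendsto (fun r : ℝ≥0 => charFun (standardizedPoisson r : Measure ℝ) t) atTop
      (𝓝 (charFun (gaussianReal 0 1) t)) := by
  have hs : Tendsto (fun r : ℝ≥0 => t / √(r : ℝ)) atTop (𝓝 0) :=
    (Real.tendsto_sqrt_atTop.comp (NNReal.tendsto_coe_atTop.2 tendsto_id)).const_div_atTop t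
  have hbound : Tendsto (fun r : ℝ≥0 => t ^ 2 * (|t / √(r : ℝ)| * Real.exp |t / √(r : ℝ)|))
      atTop (𝓝 0) := by
    have hc : Continuous fun s : ℝ => t ^ 2 * (|s| * Real.exp |s|) := by fun_prop
    simpa [Function.comp_def] using (hc.tendsto 0).comp hs
  have hexp : Tendsto (fun r : ℝ≥0 => (r : ℂ) * (Complex.exp (↑(t / √(r : ℝ)) * Complex.I) - 1
      - ↑(t / √(r : ℝ)) * Complex.I)) atTop (𝓝 (-(t : ℂ) ^ 2 / 2)) := by
    rw [tendsto_iff_norm_sub_tendsto_zero]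
    refine squeeze_zero' (.of_forall fun _ => norm_nonneg _) ?_ hbound
    filter_upwards [eventually_gt_atTop 0] with r hr
    have hrs : (r : ℝ) * (t / √(r : ℝ)) ^ 2 = t ^ 2 := by
      have : (r : ℝ) ≠ 0 := (NNReal.coe_pos.2 hr).ne'
      rw [div_pow, Real.sq_sqrt r.coe_nonneg]
      field_simp
    set s := t / √(r : ℝ)
    have hrs' : (r : ℂ) * (s : ℂ) ^ 2 = (t : ℂ) ^ 2 := by exact_mod_cast hrs
    have h := Complex.norm_exp_sub_sum_le_norm_mul_exp (s * Complex.I) 3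
    have hnorm : ‖(s : ℂ) * Complex.I‖ = |s| := by simp
    rw [hnorm] at h
    have heq : (r : ℂ) * (Complex.exp (s * Complex.I) - 1 - s * Complex.I) - -(t : ℂ) ^ 2 / 2 =
        r * (Complex.exp (s * Complex.I)
          - ∑ m ∈ Finset.range 3, (s * Complex.I) ^ m / m.factorial) := by
      simp only [Finset.sum_range_succ, Finset.sum_range_zero, Nat.factorial, mul_pow,
        Complex.I_sq, ← hrs']
      push_cast
      ring
    have hr_norm : ‖(r : ℂ)‖ = r :=
      (Complex.norm_real _).trans (Real.norm_of_nonneg r.coe_nonneg)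
    rw [heq, norm_mul, hr_norm]
    calc (r : ℝ) * _ ≤ r * (|s| ^ 3 * Real.exp |s|) := mul_le_mul_of_nonneg_left h r.coe_nonneg
      _ = r * s ^ 2 * (|s| * Real.exp |s|) := by rw [← sq_abs s]; ring
      _ = t ^ 2 * (|s| * Real.exp |s|) := by rw [hrs]
  rw [charFun_gaussianReal]
  have hlim : (t : ℂ) * (0 : ℝ) * Complex.I - (1 : ℝ≥0) * (t : ℂ) ^ 2 / 2
      = -(t : ℂ) ^ 2 / 2 := by
    simp [neg_div]
  rw [hlim]
  refine ((Complex.continuous_exp.tendsto _).comp hexp).congr' ?_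
  filter_upwards [eventually_gt_atTop 0] with r hr
  exact (charFun_standardizedPoisson hr t).symm

/-- **Central limit theorem for the Poisson distribution**, along the continuous parameter. -/
lemma tendsto_standardizedPoisson :
    Tendsto standardizedPoisson atTop (𝓝 ⟨gaussianReal 0 1, inferInstance⟩) :=
  tendsto_of_seq_tendsto fun _ hu => ProbabilityMeasure.tendsto_of_tendsto_charFun fun t =>
    (tendsto_charFun_standardizedPoisson t).comp hu

lemma standardizedPoisson_real_Iic {r : ℝ≥0} (hr : 0 < r) (z : ℝ) :
    (standardizedPoisson r : Measure ℝ).real (Set.Iic z) =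
      ∑' n : ℕ, if (n : ℝ) ≤ r + z * √(r : ℝ) then
        Real.exp (-r) * r ^ n / n.factorial else 0 := by
  have hs : 0 < √(r : ℝ) := Real.sqrt_pos.2 (NNReal.coe_pos.2 hr)
  change ((poissonMeasure r).map _).real _ = _
  rw [map_measureReal_apply .of_discrete measurableSet_Iic,
    ← integral_indicator_one .of_discrete, integral_poissonMeasure]
  congr with n
  have hiff : ((n : ℝ) - r) / √(r : ℝ) ≤ z ↔ (n : ℝ) ≤ r + z * √(r : ℝ) := by
    rw [div_le_iff₀ hs, sub_le_iff_le_add']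
  simp only [Set.indicator, Set.mem_preimage, Set.mem_Iic, hiff, Pi.one_apply, smul_eq_mul,
    mul_ite, mul_one, mul_zero]

/-- Lemma 1 of the paper: if Φ(z) = 1 − α, then as λ → ∞ the probability that a
Poisson(λ) random variable is at most λ + z·√λ converges to 1 − α. -/
theorem poisson_service_level (α : ℝ) (hα : α ∈ Set.Ioo (0 : ℝ) 1)
    (z : ℝ) (hz : Phi z = 1 - α) :
    Tendsto (fun lam : ℝ => ∑' n : ℕ,
        if (n : ℝ) ≤ lam + z * Real.sqrt lam then
          Real.exp (-lam) * lam ^ n / n.factorial else 0)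
      atTop (nhds (1 - α)) := by
  have : NullSingletonClass (gaussianReal 0 1) := nullSingletonClass_gaussianReal one_ne_zero
  have hmeas := ProbabilityMeasure.tendsto_measure_of_null_frontier_of_tendsto'
    tendsto_standardizedPoisson (E := Set.Iic z) (by simp)
  have hreal := ((ENNReal.tendsto_toReal (measure_ne_top (gaussianReal 0 1) _)).comp hmeas).comp
    tendsto_real_toNNReal_atTop
  rw [← hz]
  refine hreal.congr' ?_
  filter_upwards [eventually_gt_atTop 0] with lam hlam
  simpa [Real.coe_toNNReal lam hlam.le, Measure.real] using
    standardizedPoisson_real_Iic (Real.toNNReal_pos.2 hlam) z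
end

section
/- Let a ≥ 0, c ≥ 0, and X be real numbers. Then c·√a + a ≤ X if and only if there exists t ≥ 0 with a ≤ t² and Real.sqrt ((t + c/2)² + ((1 − X − c²/4)/2)²) ≤ (1 + X + c²/4)/2. -/
/-- The rotated second-order cone with one unit coordinate is the epigraph of the square. -/
theorem Real.sqrt_sq_add_sq_le_iff_sq_le (u y : ℝ) :
    Real.sqrt (u ^ 2 + ((1 - y) / 2) ^ 2) ≤ (1 + y) / 2 ↔ u ^ 2 ≤ y := by
  rw [Real.sqrt_le_iff]
  constructor
  · rintro ⟨-, h⟩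
    linarith
  · intro h
    have hu := sq_nonneg u
    constructor <;> linarith

/-- Proposition 3 (constraint level): the square-root resource constraint of
(P-1) is exactly representable by an auxiliary variable together with a
second-order-cone constraint. -/
theorem sqrt_constraint_iff_socp (a c X : ℝ) (ha : 0 ≤ a) (hc : 0 ≤ c) :
    c * Real.sqrt a + a ≤ X ↔
      ∃ t : ℝ, 0 ≤ t ∧ a ≤ t ^ 2 ∧
        Real.sqrt ((t + c / 2) ^ 2 + ((1 - X - c ^ 2 / 4) / 2) ^ 2) ≤
          (1 + X + c ^ 2 / 4) / 2 := by
  simp only [sub_sub, add_assoc 1 X, Real.sqrt_sq_add_sq_le_iff_sq_le]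
  constructor
  · intro h
    have hs := Real.sq_sqrt ha
    exact ⟨Real.sqrt a, Real.sqrt_nonneg a, hs.ge, by linarith⟩
  · rintro ⟨t, ht, hat, h⟩
    have hst : c * Real.sqrt a ≤ c * t :=
      mul_le_mul_of_nonneg_left (Real.sqrt_le_iff.mpr ⟨ht, hat⟩) hc
    linarith
end
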